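/- arXiv:2304.11024 — 2 statements merged into one kernel-verified Lean document; each statement's English description precedes it below -/
import Mathlib

section
/- Define f : ℝ × ℝ × (Fin m → ℝ) → ℝ by f(y, x, u) = y² − (x − 1)² + Σᵢ εᵢ·uᵢ², and the vector field ξ(y, x, u) = (y·(2x − 1), w(x), (ε₀·u₀, …, ε_{m−1}·u_{m−1})). Then for every point p = (y, x, u) with x > 1/2, the directional derivative of f along ξ at p, namely (Df)(p)(ξ(p)) = 2y²·(2x − 1) − 2(x − 1)·w(x) + 2·Σᵢ uᵢ², is nonnegative, and it equals zero if and only if p = (0, 1, 0). -/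
/-- A function that is positive on `(0, 1)` and negative off `[0, 1]` satisfies
`(x - 1) * w x < 0` for every positive `x ≠ 1`. -/
theorem sub_one_mul_neg_of_pos_of_neg {w : ℝ → ℝ}
    (hw_pos : ∀ x ∈ Set.Ioo (0:ℝ) 1, 0 < w x)
    (hw_neg : ∀ x, x ∉ Set.Icc (0:ℝ) 1 → w x < 0) {x : ℝ} (hx : 0 < x) (hx1 : x ≠ 1) :
    (x - 1) * w x < 0 := by
  rcases lt_or_gt_of_ne hx1 with h | h
  · exact mul_neg_of_neg_of_pos (by linarith) (hw_pos x ⟨hx, h⟩)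
  · exact mul_neg_of_pos_of_neg (by linarith) (hw_neg x fun h' => not_lt.2 h'.2 h)

/-- The derivative of the quadratic form `y² - (x-1)² + ∑ εᵢ uᵢ²` at `p` along `v`. -/
theorem fderiv_morse_normal_form {m : ℕ} (ε : Fin m → ℝ) (p v : ℝ × ℝ × (Fin m → ℝ)) :
    fderiv ℝ
        (fun q : ℝ × ℝ × (Fin m → ℝ) =>
          q.1 ^ 2 - (q.2.1 - 1) ^ 2 + ∑ i, ε i * (q.2.2 i) ^ 2) p v =
      2 * p.1 * v.1 - 2 * (p.2.1 - 1) * v.2.1 + ∑ i, 2 * ε i * p.2.2 i * v.2.2 i := by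
  have h1 : HasFDerivAt (fun q : ℝ × ℝ × (Fin m → ℝ) => q.1) _ p := hasFDerivAt_fst (𝕜 := ℝ)
  have h2 : HasFDerivAt (fun q : ℝ × ℝ × (Fin m → ℝ) => q.2) _ p := hasFDerivAt_snd (𝕜 := ℝ)
  have h3 (i : Fin m) := ((hasFDerivAt_apply (𝕜 := ℝ) i p.2.2).comp p h2.snd).pow 2
  have h := ((h1.pow 2).sub ((h2.fst.sub_const 1).pow 2)).add
    (HasFDerivAt.fun_sum (u := Finset.univ) fun i _ => (h3 i).const_mul (ε i))
  refine (DFunLike.congr_fun h.fderiv v).trans ?_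
  simp
  refine Finset.sum_congr rfl fun i _ => ?_
  ring

/-- For `f (y, x, u) = y² - (x-1)² + ∑ εᵢ uᵢ²` and the model vector field
`ξ (y, x, u) = (y(2x-1), w x, (εᵢ uᵢ)ᵢ)`, at every point `p = (y, x, u)` with `x > 1/2`
the directional derivative of `f` along `ξ` equals
`2y²(2x-1) - 2(x-1)·w(x) + 2∑ uᵢ²`, is nonnegative, and vanishes iff `p = (0,1,0)`. -/
theorem stmt_6 (m : ℕ) (w : ℝ → ℝ) (ε : Fin m → ℝ)
    (hw : ContDiff ℝ 1 w)
    (hw_pos : ∀ x ∈ Set.Ioo (0:ℝ) 1, 0 < w x)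
    (hw_neg : ∀ x, x ∉ Set.Icc (0:ℝ) 1 → w x < 0)
    (hε : ∀ i, ε i = -1 ∨ ε i = 1) :
    ∀ p : ℝ × ℝ × (Fin m → ℝ), 1 / 2 < p.2.1 →
      fderiv ℝ
          (fun q : ℝ × ℝ × (Fin m → ℝ) =>
            q.1 ^ 2 - (q.2.1 - 1) ^ 2 + ∑ i, ε i * (q.2.2 i) ^ 2) p
          (p.1 * (2 * p.2.1 - 1), w p.2.1, fun i => ε i * p.2.2 i) =
        2 * p.1 ^ 2 * (2 * p.2.1 - 1) - 2 * (p.2.1 - 1) * w p.2.1 + 2 * (∑ i, (p.2.2 i) ^ 2) ∧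
      0 ≤ 2 * p.1 ^ 2 * (2 * p.2.1 - 1) - 2 * (p.2.1 - 1) * w p.2.1 + 2 * (∑ i, (p.2.2 i) ^ 2) ∧
      (2 * p.1 ^ 2 * (2 * p.2.1 - 1) - 2 * (p.2.1 - 1) * w p.2.1 + 2 * (∑ i, (p.2.2 i) ^ 2) = 0 ↔
        p = ((0 : ℝ), (1 : ℝ), (0 : Fin m → ℝ))) := by
  intro p hp
  refine ⟨?_, ?_⟩
  · rw [fderiv_morse_normal_form, Finset.mul_sum]
    have hsum : ∑ i, 2 * ε i * p.2.2 i * (ε i * p.2.2 i) = ∑ i, 2 * p.2.2 i ^ 2 := by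
      refine Finset.sum_congr rfl fun i _ => ?_
      rcases hε i with h | h <;> rw [h] <;> ring
    rw [hsum]
    ring
  obtain ⟨y, x, u⟩ := p
  dsimp only at hp ⊢
  have hx : 0 < 2 * x - 1 := by linarith
  have hy : 0 ≤ 2 * y ^ 2 * (2 * x - 1) := by positivity
  have hu : 0 ≤ ∑ i, u i ^ 2 := Finset.sum_nonneg fun i _ => sq_nonneg _
  have hneg : x ≠ 1 → (x - 1) * w x < 0 :=
    sub_one_mul_neg_of_pos_of_neg hw_pos hw_neg (by linarith)
  have hxw : (x - 1) * w x ≤ 0 := by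
    rcases eq_or_ne x 1 with rfl | h
    · simp
    · exact (hneg h).le
  refine ⟨by linarith, fun h => ?_, fun h => ?_⟩
  · have hx1 : x = 1 := by
      by_contra hne
      linarith [hneg hne]
    have hy0 : 2 * y ^ 2 * (2 * x - 1) = 0 := by linarith
    have hu0 : ∑ i, u i ^ 2 = 0 := by linarith
    have hy1 : y = 0 := by simpa [hx.ne'] using hy0
    have hu1 : u = 0 := by
      funext i
      rw [Finset.sum_eq_zero_iff_of_nonneg fun i _ => sq_nonneg _] at hu0
      simpa using hu0 i (Finset.mem_univ i)
    rw [hx1, hy1, hu1]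
  · simp only [Prod.mk.injEq] at h
    obtain ⟨rfl, rfl, rfl⟩ := h
    simp
end

section
/- Define the vector field V : ℝ × ℝ × (Fin m → ℝ) → ℝ × ℝ × (Fin m → ℝ) by V(y, x, u) = (y·(2x − 1), w(x) − c·α(x)·β(y), (ε₀·u₀, …, ε_{m−1}·u_{m−1})), and let y₀ > 0 satisfy c·β(y₀) = w(1/2). Suppose γ : ℝ → ℝ × ℝ × (Fin m → ℝ) satisfies, for every t ≥ 0, that γ is differentiable at t with γ'(t) = V(γ(t)) and that the first coordinate of γ(t) is nonnegative, and suppose the set {γ(t) : t ≥ 0} is bounded. Then γ(t) converges to (y₀, 1/2, 0) as t → +∞. -/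
open Filter Topology Set

lemma hasDerivAt_min_zero_sq (x : ℝ) :
    HasDerivAt (fun x : ℝ => (min x 0) ^ 2) (2 * min x 0) x := by
  rcases lt_trichotomy x 0 with h | rfl | h
  · have h1 : HasDerivAt (fun x : ℝ => x ^ 2) (2 * min x 0) x := by
      simpa [min_eq_left h.le] using hasDerivAt_pow 2 x
    refine h1.congr_of_eventuallyEq ?_
    filter_upwards [Iio_mem_nhds h] with z hz
    rw [min_eq_left (le_of_lt hz)]
  · have h1 : HasFDerivAt (fun x : ℝ => (min x 0) ^ 2) (0 : ℝ →L[ℝ] ℝ) 0 := by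
      refine Asymptotics.IsBigO.hasFDerivAt (n := 2) ?_ (by norm_num)
      refine Asymptotics.IsBigO.of_bound 1 (Eventually.of_forall fun z => ?_)
      rcases le_total z 0 with hz | hz
      · simp [min_eq_left hz]
      · simp [min_eq_right hz, sq_nonneg]
    simpa using h1.hasDerivAt
  · have h1 : HasDerivAt (fun _ : ℝ => (0 : ℝ)) (2 * min x 0) x := by
      simpa [min_eq_right h.le] using hasDerivAt_const x (0 : ℝ)
    refine h1.congr_of_eventuallyEq ?_
    filter_upwards [Ioi_mem_nhds h] with z hz
    simp [min_eq_right (mem_Ioi.1 hz).le]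

/-- The closed first quadrant is forward invariant under a planar linear cooperative system. -/
lemma nonneg_of_linear_cooperative {p q A a D b : ℝ → ℝ} {t₀ : ℝ}
    (hp : ∀ t ≥ t₀, HasDerivAt p (A t * p t + a t * q t) t)
    (hq : ∀ t ≥ t₀, HasDerivAt q (D t * q t + b t * p t) t)
    (hA : ContinuousOn A (Ici t₀)) (ha : ContinuousOn a (Ici t₀))
    (hD : ContinuousOn D (Ici t₀)) (hb : ContinuousOn b (Ici t₀))
    (ha0 : ∀ t ≥ t₀, 0 ≤ a t) (hb0 : ∀ t ≥ t₀, 0 ≤ b t)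
    (hp0 : 0 ≤ p t₀) (hq0 : 0 ≤ q t₀) {T : ℝ} (hT : t₀ ≤ T) : 0 ≤ p T ∧ 0 ≤ q T := by
  have hk : ContinuousOn (fun t => 2 * |A t| + 2 * |D t| + a t + b t) (Icc t₀ T) :=
    (((hA.abs.const_smul (2 : ℝ)).add (hD.abs.const_smul (2 : ℝ))).add ha |>.add hb).mono
      Icc_subset_Ici_self
  obtain ⟨K, hK⟩ := (isCompact_Icc.image_of_continuousOn hk).bddAbove
  have hKt : ∀ t ∈ Icc t₀ T, 2 * |A t| + 2 * |D t| + a t + b t ≤ K :=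
    fun t ht => hK (mem_image_of_mem _ ht)
  let f : ℝ → ℝ := fun t => ((min (p t) 0) ^ 2 + (min (q t) 0) ^ 2) * Real.exp (-K * t)
  have hf : ∀ t ∈ Icc t₀ T, HasDerivAt f
      ((2 * min (p t) 0 * (A t * p t + a t * q t) + 2 * min (q t) 0 * (D t * q t + b t * p t))
        * Real.exp (-K * t) + ((min (p t) 0) ^ 2 + (min (q t) 0) ^ 2)
        * (Real.exp (-K * t) * (-K * 1))) t := fun t ht =>
    (((hasDerivAt_min_zero_sq (p t)).comp t (hp t ht.1)).add
      ((hasDerivAt_min_zero_sq (q t)).comp t (hq t ht.1))).mul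
      (((hasDerivAt_id t).const_mul (-K)).exp)
  have hanti : AntitoneOn f (Icc t₀ T) := by
    refine antitoneOn_of_hasDerivWithinAt_nonpos (convex_Icc _ _)
      (fun t ht => (hf t ht).continuousAt.continuousWithinAt)
      (fun t ht => (hf t (interior_subset ht)).hasDerivWithinAt) ?_
    intro t ht
    have ht' := interior_subset ht
    have hk := hKt t ht'
    have ha := ha0 t ht'.1
    have hb := hb0 t ht'.1
    have hE := Real.exp_pos (-K * t)
    have e1 : min (p t) 0 * p t = (min (p t) 0) ^ 2 := by
      rcases le_total (p t) 0 with h | h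
      · simp [min_eq_left h, sq]
      · simp [min_eq_right h]
    have e2 : min (q t) 0 * q t = (min (q t) 0) ^ 2 := by
      rcases le_total (q t) 0 with h | h
      · simp [min_eq_left h, sq]
      · simp [min_eq_right h]
    have e3 : min (p t) 0 * q t ≤ min (p t) 0 * min (q t) 0 :=
      mul_le_mul_of_nonpos_left (min_le_left _ _) (min_le_right _ _)
    have e4 : min (q t) 0 * p t ≤ min (p t) 0 * min (q t) 0 := by
      rw [mul_comm (min (p t) 0)]
      exact mul_le_mul_of_nonpos_left (min_le_left _ _) (min_le_right _ _)
    generalize min (p t) 0 = P at *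
    generalize min (q t) 0 = Q at *
    have e5 : 2 * (P * Q) ≤ P ^ 2 + Q ^ 2 := by nlinarith [sq_nonneg (P - Q)]
    have h1 : 2 * P * (A t * p t + a t * q t) + 2 * Q * (D t * q t + b t * p t)
        ≤ K * (P ^ 2 + Q ^ 2) := by
      have i1 : A t * P ^ 2 ≤ |A t| * P ^ 2 :=
        mul_le_mul_of_nonneg_right (le_abs_self _) (sq_nonneg _)
      have i2 : D t * Q ^ 2 ≤ |D t| * Q ^ 2 :=
        mul_le_mul_of_nonneg_right (le_abs_self _) (sq_nonneg _)
      have i3 := mul_le_mul_of_nonneg_left e3 ha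
      have i4 := mul_le_mul_of_nonneg_left e4 hb
      have i5 := mul_le_mul_of_nonneg_left e5 (add_nonneg ha hb)
      have i6 := mul_le_mul_of_nonneg_right hk (add_nonneg (sq_nonneg P) (sq_nonneg Q))
      have i7 := mul_nonneg (abs_nonneg (A t)) (sq_nonneg Q)
      have i8 := mul_nonneg (abs_nonneg (D t)) (sq_nonneg P)
      calc _ = 2 * (A t * (P * p t)) + 2 * (a t * (P * q t)) + 2 * (D t * (Q * q t))
            + 2 * (b t * (Q * p t)) := by ring
        _ ≤ _ := by rw [e1, e2]; linarith
    calc _ = (2 * P * (A t * p t + a t * q t) + 2 * Q * (D t * q t + b t * p t)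
            - K * (P ^ 2 + Q ^ 2)) * Real.exp (-K * t) := by ring
      _ ≤ 0 := mul_nonpos_of_nonpos_of_nonneg (by linarith) hE.le
  have hle := hanti (left_mem_Icc.2 hT) (right_mem_Icc.2 hT) hT
  have h0 : f t₀ = 0 := by simp [f, min_eq_right hp0, min_eq_right hq0]
  rw [h0] at hle
  have hsum : (min (p T) 0) ^ 2 + (min (q T) 0) ^ 2 ≤ 0 :=
    nonpos_of_mul_nonpos_left hle (Real.exp_pos _)
  have hP : min (p T) 0 = 0 := by
    have := sq_nonneg (min (p T) 0)
    have := sq_nonneg (min (q T) 0)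
    exact pow_eq_zero_iff (two_ne_zero) |>.1 (by linarith)
  have hQ : min (q T) 0 = 0 := by
    have := sq_nonneg (min (p T) 0)
    have := sq_nonneg (min (q T) 0)
    exact pow_eq_zero_iff (two_ne_zero) |>.1 (by linarith)
  exact ⟨min_eq_right_iff.1 hP, min_eq_right_iff.1 hQ⟩

/-- A nowhere vanishing continuous function on a half-line has constant sign. -/
lemma ContinuousOn.pos_or_neg_of_ne_zero_Ici {p : ℝ → ℝ} {t₀ : ℝ} (hp : ContinuousOn p (Ici t₀))
    (h : ∀ t ≥ t₀, p t ≠ 0) : (∀ t ≥ t₀, 0 < p t) ∨ ∀ t ≥ t₀, p t < 0 := by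
  by_contra! hcon
  obtain ⟨⟨s, hs, hps⟩, r, hr, hpr⟩ := hcon
  obtain ⟨z, hz, hz0⟩ := isPreconnected_Ici.intermediate_value hs hr hp ⟨hps, hpr⟩
  exact h z hz hz0

lemma exists_sign_of_linear_cooperative {p q A a D b : ℝ → ℝ} {t₀ : ℝ}
    (hp : ∀ t ≥ t₀, HasDerivAt p (A t * p t + a t * q t) t)
    (hq : ∀ t ≥ t₀, HasDerivAt q (D t * q t + b t * p t) t)
    (hA : ContinuousOn A (Ici t₀)) (ha : ContinuousOn a (Ici t₀))
    (hD : ContinuousOn D (Ici t₀)) (hb : ContinuousOn b (Ici t₀))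
    (ha0 : ∀ t ≥ t₀, 0 ≤ a t) (hb0 : ∀ t ≥ t₀, 0 ≤ b t) :
    ∃ s ≥ t₀, ((∀ t ≥ s, 0 ≤ p t) ∨ ∀ t ≥ s, p t ≤ 0) ∧
      ((∀ t ≥ s, 0 ≤ q t) ∨ ∀ t ≥ s, q t ≤ 0) := by
  by_cases h1 : ∃ s ≥ t₀, 0 ≤ p s ∧ 0 ≤ q s
  · obtain ⟨s, hs, hps, hqs⟩ := h1
    have hsub : Ici s ⊆ Ici t₀ := Ici_subset_Ici.2 hs
    have key : ∀ t ≥ s, 0 ≤ p t ∧ 0 ≤ q t := fun t ht =>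
      nonneg_of_linear_cooperative (fun t ht => hp t (hs.trans ht)) (fun t ht => hq t (hs.trans ht))
        (hA.mono hsub) (ha.mono hsub) (hD.mono hsub) (hb.mono hsub)
        (fun t ht => ha0 t (hs.trans ht)) (fun t ht => hb0 t (hs.trans ht)) hps hqs ht
    exact ⟨s, hs, .inl fun t ht => (key t ht).1, .inl fun t ht => (key t ht).2⟩
  by_cases h2 : ∃ s ≥ t₀, p s ≤ 0 ∧ q s ≤ 0
  · obtain ⟨s, hs, hps, hqs⟩ := h2
    have hsub : Ici s ⊆ Ici t₀ := Ici_subset_Ici.2 hs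
    have key : ∀ t ≥ s, 0 ≤ -p t ∧ 0 ≤ -q t := fun t ht =>
      nonneg_of_linear_cooperative (p := fun t => -p t) (q := fun t => -q t)
        (fun t ht => ((hp t (hs.trans ht)).fun_neg).congr_deriv (by ring))
        (fun t ht => ((hq t (hs.trans ht)).fun_neg).congr_deriv (by ring))
        (hA.mono hsub) (ha.mono hsub) (hD.mono hsub) (hb.mono hsub)
        (fun t ht => ha0 t (hs.trans ht)) (fun t ht => hb0 t (hs.trans ht))
        (neg_nonneg.2 hps) (neg_nonneg.2 hqs) ht
    exact ⟨s, hs, .inr fun t ht => neg_nonneg.1 (key t ht).1,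
      .inr fun t ht => neg_nonneg.1 (key t ht).2⟩
  push Not at h1 h2
  have hp0 : ∀ t ≥ t₀, p t ≠ 0 := fun t ht h0 =>
    (h1 t ht h0.ge).not_gt (h2 t ht h0.le)
  refine ⟨t₀, le_rfl, ?_⟩
  rcases ContinuousOn.pos_or_neg_of_ne_zero_Ici
    (fun t ht => (hp t ht).continuousAt.continuousWithinAt) hp0 with h | h
  · exact ⟨.inl fun t ht => (h t ht).le, .inr fun t ht => (h1 t ht (h t ht).le).le⟩
  · exact ⟨.inr fun t ht => (h t ht).le, .inl fun t ht => (h2 t ht (h t ht).le).le⟩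

lemma exists_tendsto_of_hasDerivAt_nonneg {f f' : ℝ → ℝ} {s B : ℝ}
    (hf : ∀ t ≥ s, HasDerivAt f (f' t) t) (hf' : ∀ t ≥ s, 0 ≤ f' t) (hB : ∀ t ≥ s, f t ≤ B) :
    ∃ L, Tendsto f atTop (𝓝 L) := by
  have hmono : MonotoneOn f (Ici s) :=
    monotoneOn_of_hasDerivWithinAt_nonneg (convex_Ici s)
      (fun t ht => (hf t ht).continuousAt.continuousWithinAt)
      (fun t ht => (hf t (interior_subset ht)).hasDerivWithinAt)
      (fun t ht => hf' t (interior_subset ht))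
  have hg : Monotone fun t => f (max t s) := fun x y hxy =>
    hmono (mem_Ici.2 (le_max_right _ _)) (mem_Ici.2 (le_max_right _ _)) (max_le_max_right s hxy)
  have hlim := tendsto_atTop_ciSup hg
    ⟨B, by rintro _ ⟨t, rfl⟩; exact hB _ (le_max_right _ _)⟩
  refine ⟨_, hlim.congr' ?_⟩
  filter_upwards [eventually_ge_atTop s] with t ht
  rw [max_eq_left ht]

lemma exists_tendsto_of_hasDerivAt_sign {f f' : ℝ → ℝ} {s B : ℝ}
    (hf : ∀ t ≥ s, HasDerivAt f (f' t) t)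
    (hf' : (∀ t ≥ s, 0 ≤ f' t) ∨ ∀ t ≥ s, f' t ≤ 0) (hB : ∀ t ≥ s, |f t| ≤ B) :
    ∃ L, Tendsto f atTop (𝓝 L) := by
  rcases hf' with h | h
  · exact exists_tendsto_of_hasDerivAt_nonneg hf h fun t ht => (abs_le.1 (hB t ht)).2
  · obtain ⟨L, hL⟩ := exists_tendsto_of_hasDerivAt_nonneg (f := fun t => -f t)
      (fun t ht => (hf t ht).fun_neg) (fun t ht => neg_nonneg.2 (h t ht))
      (B := B) (fun t ht => by linarith [(abs_le.1 (hB t ht)).1])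
    exact ⟨-L, by simpa using hL.neg⟩

lemma eq_zero_of_tendsto_of_tendsto_deriv {f f' : ℝ → ℝ} {s L M : ℝ}
    (hf : ∀ t ≥ s, HasDerivAt f (f' t) t) (hL : Tendsto f atTop (𝓝 L))
    (hM : Tendsto f' atTop (𝓝 M)) : M = 0 := by
  have hex : ∀ t ≥ s, ∃ ξ > t, f' ξ = f (t + 1) - f t := by
    intro t ht
    obtain ⟨ξ, hξ, h⟩ := exists_hasDerivAt_eq_slope f f' (lt_add_one t)
      (fun u hu => (hf u (ht.trans hu.1)).continuousAt.continuousWithinAt)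
      (fun u hu => hf u (ht.trans hu.1.le))
    exact ⟨ξ, hξ.1, by simpa using h⟩
  choose! ξ hξ hξ' using hex
  have hξtop : Tendsto ξ atTop atTop := by
    refine tendsto_atTop_mono' _ ?_ tendsto_id
    filter_upwards [eventually_ge_atTop s] with t ht using (hξ t ht).le
  have h1 : Tendsto (fun t => f (t + 1) - f t) atTop (𝓝 M) := by
    refine (hM.comp hξtop).congr' ?_
    filter_upwards [eventually_ge_atTop s] with t ht using hξ' t ht
  have h2 : Tendsto (fun t => f (t + 1) - f t) atTop (𝓝 (L - L)) :=
    (hL.comp (tendsto_atTop_add_const_right _ 1 tendsto_id)).sub hL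
  simpa using tendsto_nhds_unique h1 h2

lemma eq_mul_exp_of_hasDerivAt {u : ℝ → ℝ} {e : ℝ}
    (hu : ∀ t ≥ (0 : ℝ), HasDerivAt u (e * u t) t) {t : ℝ} (ht : 0 ≤ t) :
    u t = u 0 * Real.exp (e * t) := by
  have hg : ∀ s ≥ (0 : ℝ), HasDerivAt (fun s => u s * Real.exp (-e * s)) 0 s := fun s hs =>
    ((hu s hs).mul (((hasDerivAt_id s).const_mul (-e)).exp)).congr_deriv (by simp only [id]; ring)
  have hc := constant_of_has_deriv_right_zero (a := 0) (b := t)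
    (fun s hs => (hg s hs.1).continuousAt.continuousWithinAt)
    (fun s hs => (hg s hs.1).hasDerivWithinAt) t ⟨ht, le_rfl⟩
  simp only [mul_zero, Real.exp_zero, mul_one] at hc
  rw [← hc, mul_assoc, ← Real.exp_add]
  simp

lemma tendsto_zero_of_hasDerivAt_of_bounded {u : ℝ → ℝ} {e B : ℝ} (he : e = -1 ∨ e = 1)
    (hu : ∀ t ≥ (0 : ℝ), HasDerivAt u (e * u t) t) (hB : ∀ t ≥ (0 : ℝ), |u t| ≤ B) :
    Tendsto u atTop (𝓝 0) := by
  have hev : (fun t => u 0 * Real.exp (e * t)) =ᶠ[atTop] u := by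
    filter_upwards [eventually_ge_atTop 0] with t ht using (eq_mul_exp_of_hasDerivAt hu ht).symm
  refine Tendsto.congr' hev ?_
  rcases he with rfl | rfl
  · simpa using (Real.tendsto_exp_neg_atTop_nhds_zero).const_mul (u 0)
  · have h0 : u 0 = 0 := by
      by_contra h0
      have htop : Tendsto (fun t => |u 0| * Real.exp t) atTop atTop :=
        Real.tendsto_exp_atTop.const_mul_atTop (abs_pos.2 h0)
      obtain ⟨t, ht, ht0⟩ := ((htop.eventually_gt_atTop B).and (eventually_ge_atTop 0)).exists
      have h := hB t ht0
      rw [eq_mul_exp_of_hasDerivAt hu ht0, abs_mul, Real.abs_exp, one_mul] at h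
      linarith
    simp [h0]

section Cutoff

variable {β : ℝ → ℝ}

lemma deriv_nonpos_of_cutoff (hβ01 : ∀ y, β y ∈ Icc (0 : ℝ) 1)
    (hβ' : ∀ y, 0 < β y → β y < 1 → deriv β y < 0) (y : ℝ) : deriv β y ≤ 0 := by
  rcases (hβ01 y).1.eq_or_lt with h0 | h0
  · refine (IsLocalMin.deriv_eq_zero (Eventually.of_forall fun z => ?_)).le
    rw [← h0]; exact (hβ01 z).1
  rcases (hβ01 y).2.eq_or_lt with h1 | h1
  · refine (IsLocalMax.deriv_eq_zero (Eventually.of_forall fun z => ?_)).le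
    rw [h1]; exact (hβ01 z).2
  · exact (hβ' y h0 h1).le

lemma eq_of_cutoff_eq (hβ : Differentiable ℝ β) (hβ01 : ∀ y, β y ∈ Icc (0 : ℝ) 1)
    (hβ' : ∀ y, 0 < β y → β y < 1 → deriv β y < 0) {y z : ℝ} (hyz : β y = β z)
    (h0 : 0 < β y) (h1 : β y < 1) : y = z := by
  have key : ∀ {y z : ℝ}, β y = β z → 0 < β y → β y < 1 → ¬ y < z := by
    intro y z hyz h0 h1 hlt
    have hanti := antitone_of_deriv_nonpos hβ (deriv_nonpos_of_cutoff hβ01 hβ')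
    obtain ⟨ξ, hξ, hd⟩ := exists_deriv_eq_zero hlt hβ.continuous.continuousOn hyz
    have h2 := hanti hξ.1.le
    have h3 := hanti hξ.2.le
    exact (hβ' ξ (by linarith) (by linarith)).ne hd
  rcases lt_trichotomy y z with h | h | h
  · exact (key hyz h0 h1 h).elim
  · exact h
  · exact (key hyz.symm (hyz ▸ h0) (hyz ▸ h1) h).elim

end Cutoff


/-- key lemma: Every forward trajectory of the perturbed vector field
`V (y, x, u) = (y(2x-1), w x - c α(x) β(y), (εᵢ uᵢ)ᵢ)` which stays in a bounded region of
the half-space `{y ≥ 0}` converges to the unique interior zero `(y₀, 1/2, 0)`. -/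
theorem stmt_12 (m : ℕ) (hm : 1 ≤ m) (w α β : ℝ → ℝ) (c y₀ : ℝ) (ε : Fin m → ℝ)
    (hw : ContDiff ℝ 1 w)
    (hw_pos : ∀ x ∈ Set.Ioo (0:ℝ) 1, 0 < w x)
    (hw_neg : ∀ x, x ∉ Set.Icc (0:ℝ) 1 → w x < 0)
    (hα : ContDiff ℝ 1 α)
    (hα01 : ∀ x, α x ∈ Set.Icc (0:ℝ) 1)
    (hα1 : ∀ x ∈ Set.Icc (0:ℝ) 1, α x = 1)
    (hβ : ContDiff ℝ 1 β)
    (hβ01 : ∀ y, β y ∈ Set.Icc (0:ℝ) 1)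
    (hβ0 : β 0 = 1)
    (hβY : ∃ Y > (0:ℝ), β Y = 0)
    (hβ' : ∀ y, 0 < β y → β y < 1 → deriv β y < 0)
    (hc : 0 < c)
    (hwc : ∀ x ∈ Set.Icc (0:ℝ) 1, w x < c)
    (hε : ∀ i, ε i = -1 ∨ ε i = 1)
    (hy₀ : 0 < y₀) (hy₀β : c * β y₀ = w (1 / 2))
    (γ : ℝ → ℝ × ℝ × (Fin m → ℝ))
    (hγ : ∀ t ≥ (0 : ℝ),
      HasDerivAt γ
        ((γ t).1 * (2 * (γ t).2.1 - 1),
          w (γ t).2.1 - c * α (γ t).2.1 * β (γ t).1,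
          fun i => ε i * (γ t).2.2 i) t ∧
      0 ≤ (γ t).1)
    (hbdd : Bornology.IsBounded (γ '' Set.Ici 0)) :
    Filter.Tendsto γ Filter.atTop (nhds (y₀, 1 / 2, (0 : Fin m → ℝ))) := by
  obtain ⟨B, hB⟩ := isBounded_iff_forall_norm_le.1 hbdd
  have hγB : ∀ t ≥ (0 : ℝ), ‖γ t‖ ≤ B := fun t ht => hB _ (mem_image_of_mem _ ht)
  let y : ℝ → ℝ := fun t => (γ t).1
  let x : ℝ → ℝ := fun t => (γ t).2.1
  let u : Fin m → ℝ → ℝ := fun i t => (γ t).2.2 i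
  let p : ℝ → ℝ := fun t => y t * (2 * x t - 1)
  let q : ℝ → ℝ := fun t => w (x t) - c * α (x t) * β (y t)
  have hy : ∀ t ≥ (0 : ℝ), HasDerivAt y (p t) t := fun t ht =>
    (ContinuousLinearMap.fst ℝ ℝ (ℝ × (Fin m → ℝ))).hasFDerivAt.comp_hasDerivAt t (hγ t ht).1
  have hxu : ∀ t ≥ (0 : ℝ), HasDerivAt (fun t => (γ t).2) (q t, fun i => ε i * u i t) t :=
    fun t ht => (ContinuousLinearMap.snd ℝ ℝ (ℝ × (Fin m → ℝ))).hasFDerivAt.comp_hasDerivAt t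
      (hγ t ht).1
  have hx : ∀ t ≥ (0 : ℝ), HasDerivAt x (q t) t := fun t ht =>
    (ContinuousLinearMap.fst ℝ ℝ (Fin m → ℝ)).hasFDerivAt.comp_hasDerivAt t (hxu t ht)
  have hu : ∀ i, ∀ t ≥ (0 : ℝ), HasDerivAt (u i) (ε i * u i t) t := fun i t ht =>
    hasDerivAt_pi.1 ((ContinuousLinearMap.snd ℝ ℝ (Fin m → ℝ)).hasFDerivAt.comp_hasDerivAt t
      (hxu t ht)) i
  have hy0 : ∀ t ≥ (0 : ℝ), 0 ≤ y t := fun t ht => (hγ t ht).2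
  have hyB : ∀ t ≥ (0 : ℝ), |y t| ≤ B := fun t ht => (norm_fst_le (γ t)).trans (hγB t ht)
  have hxB : ∀ t ≥ (0 : ℝ), |x t| ≤ B := fun t ht =>
    ((norm_fst_le (γ t).2).trans (norm_snd_le (γ t))).trans (hγB t ht)
  have huB : ∀ i, ∀ t ≥ (0 : ℝ), |u i t| ≤ B := fun i t ht =>
    (((norm_le_pi_norm (γ t).2.2 i).trans (norm_snd_le (γ t).2)).trans
      (norm_snd_le (γ t))).trans (hγB t ht)
  have hyc : ContinuousOn y (Ici 0) := fun t ht => (hy t ht).continuousAt.continuousWithinAt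
  have hxc : ContinuousOn x (Ici 0) := fun t ht => (hx t ht).continuousAt.continuousWithinAt
  have hwd : Differentiable ℝ w := hw.differentiable one_ne_zero
  have hαd : Differentiable ℝ α := hα.differentiable one_ne_zero
  have hβd : Differentiable ℝ β := hβ.differentiable one_ne_zero
  have hw'c : Continuous (deriv w) := hw.continuous_deriv le_rfl
  have hα'c : Continuous (deriv α) := hα.continuous_deriv le_rfl
  have hβ'c : Continuous (deriv β) := hβ.continuous_deriv le_rfl
  have hp : ∀ t ≥ (0 : ℝ), HasDerivAt p ((2 * x t - 1) * p t + (2 * y t) * q t) t := fun t ht =>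
    ((hy t ht).mul (((hx t ht).const_mul 2).sub_const 1)).congr_deriv (by ring)
  have hq : ∀ t ≥ (0 : ℝ), HasDerivAt q
      ((deriv w (x t) - c * deriv α (x t) * β (y t)) * q t
        + (c * α (x t) * -deriv β (y t)) * p t) t := fun t ht =>
    (((hwd (x t)).hasDerivAt.comp t (hx t ht)).sub
      ((((hαd (x t)).hasDerivAt.comp t (hx t ht)).const_mul c).mul
        ((hβd (y t)).hasDerivAt.comp t (hy t ht)))).congr_deriv (by
          simp only [Function.comp_apply]; ring)
  obtain ⟨s, hs, hps, hqs⟩ := exists_sign_of_linear_cooperative hp hq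
    (by fun_prop) (by fun_prop)
    ((hw'c.comp_continuousOn hxc).sub
      ((continuousOn_const.mul (hα'c.comp_continuousOn hxc)).mul
        (hβd.continuous.comp_continuousOn hyc)))
    ((continuousOn_const.mul (hαd.continuous.comp_continuousOn hxc)).mul
      (hβ'c.comp_continuousOn hyc).neg)
    (fun t ht => mul_nonneg zero_le_two (hy0 t ht))
    (fun t _ => mul_nonneg (mul_nonneg hc.le (hα01 _).1)
      (neg_nonneg.2 (deriv_nonpos_of_cutoff hβ01 hβ' _)))
  obtain ⟨Y, hY⟩ := exists_tendsto_of_hasDerivAt_sign (fun t ht => hy t (hs.trans ht)) hps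
    (fun t ht => hyB t (hs.trans ht))
  obtain ⟨X, hX⟩ := exists_tendsto_of_hasDerivAt_sign (fun t ht => hx t (hs.trans ht)) hqs
    (fun t ht => hxB t (hs.trans ht))
  have hp0 : Y * (2 * X - 1) = 0 :=
    eq_zero_of_tendsto_of_tendsto_deriv hy hY (hY.mul ((hX.const_mul 2).sub_const 1))
  have hq0 : w X - c * α X * β Y = 0 :=
    eq_zero_of_tendsto_of_tendsto_deriv hx hX
      (((hwd.continuous.tendsto X).comp hX).sub
        ((((hαd.continuous.tendsto X).comp hX).const_mul c).mul
          ((hβd.continuous.tendsto Y).comp hY)))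
  have hXI : X ∈ Icc (0 : ℝ) 1 := by
    by_contra hX'
    have h1 := hw_neg X hX'
    have h2 := mul_nonneg (mul_nonneg hc.le (hα01 X).1) (hβ01 Y).1
    linarith
  rw [hα1 X hXI, mul_one] at hq0
  have hXhalf : X = 1 / 2 := by
    rcases mul_eq_zero.1 hp0 with h | h
    · rw [h, hβ0] at hq0
      linarith [hwc X hXI]
    · linarith
  have hYy : Y = y₀ := by
    rw [hXhalf, ← hy₀β] at hq0
    have hβY' : β y₀ = β Y := mul_left_cancel₀ hc.ne' (by linarith)
    have hw0 := hw_pos (1 / 2) (by norm_num)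
    have hw1 := hwc (1 / 2) (by norm_num)
    refine (eq_of_cutoff_eq hβd hβ01 hβ' hβY' ?_ ?_).symm
    · exact pos_of_mul_pos_right (hy₀β ▸ hw0) hc.le
    · by_contra! h
      nlinarith
  rw [hXhalf] at hX
  rw [hYy] at hY
  exact hY.prodMk_nhds (hX.prodMk_nhds (tendsto_pi_nhds.2 fun i =>
    tendsto_zero_of_hasDerivAt_of_bounded (hε i) (hu i) (huB i)))
end
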